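/- arXiv:2009.12337 — 2 statements merged into one kernel-verified Lean document; each statement's English description precedes it below -/
import Mathlib

section
/- Let n be a positive integer and let μ be a probability measure on ℝ whose cumulative distribution function F(x) = μ((−∞,x]) is continuous and strictly increasing with range (0,1). Let X_1,...,X_n be i.i.d. with law μ and let U_1,...,U_n be i.i.d. uniform on (0,1). Then for any two subsets I_1, I_2 ⊆ {1,...,n}, the mutual information I(X_(I_1); X_(I_2)) between the tuples of order statistics (X_(i))_{i∈I_1} and (X_(i))_{i∈I_2} equals the mutual information I(U_(I_1); U_(I_2)) between (U_(i))_{i∈I_1} and (U_(i))_{i∈I_2}; in particular I(X_(I_1); X_(I_2)) does not depend on μ. -/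
open MeasureTheory Real Filter Topology Classical

noncomputable section

/-- Kullback–Leibler divergence: `∫ log (dP/dQ) dP` when `P ≪ Q`, and `+∞` otherwise. -/
def klDiv {α : Type*} [MeasurableSpace α] (P Q : Measure α) : EReal :=
  if P ≪ Q then ((∫ x, Real.log ((P.rnDeriv Q x).toReal) ∂P : ℝ) : EReal) else ⊤

/-- The nondecreasing rearrangement of a tuple: `sortTuple x i` is the `i`-th order
statistic (0-indexed) of the vector `x`. -/
def sortTuple {n : ℕ} (x : Fin n → ℝ) : Fin n → ℝ := x ∘ Tuple.sort x

/-- Law of an i.i.d. sample of size `n` from `μ`. -/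
def sampleLaw (n : ℕ) (μ : Measure ℝ) : Measure (Fin n → ℝ) := Measure.pi fun _ => μ

/-- Law of the `i`-th order statistic (0-indexed) of an i.i.d. sample of size `n` from `μ`. -/
def osLaw (n : ℕ) (μ : Measure ℝ) (i : Fin n) : Measure ℝ :=
  (sampleLaw n μ).map fun x => sortTuple x i

/-- Joint law of the order statistics indexed by `I`. -/
def orderLaw (n : ℕ) (μ : Measure ℝ) (I : Finset (Fin n)) : Measure (I → ℝ) :=
  (sampleLaw n μ).map fun x (i : I) => sortTuple x i.1

/-- Product of the marginal laws of the order statistics indexed by `I`. -/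
def orderProdLaw (n : ℕ) (μ : Measure ℝ) (I : Finset (Fin n)) : Measure (I → ℝ) :=
  Measure.pi fun i : I => osLaw n μ i.1

/-- Mutual information between two tuples of order statistics. -/
def miTuples (n : ℕ) (μ : Measure ℝ) (I₁ I₂ : Finset (Fin n)) : EReal :=
  klDiv
    ((sampleLaw n μ).map fun x =>
      ((fun i : I₁ => sortTuple x i.1), (fun i : I₂ => sortTuple x i.1)))
    ((orderLaw n μ I₁).prod (orderLaw n μ I₂))

/-- Mutual information between two single order statistics (0-indexed). -/
def miPair (n : ℕ) (μ : Measure ℝ) (r m : Fin n) : EReal :=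
  klDiv ((sampleLaw n μ).map fun x => (sortTuple x r, sortTuple x m))
    ((osLaw n μ r).prod (osLaw n μ m))

/-- The uniform probability measure on `(0,1)`. -/
def unif : Measure ℝ := volume.restrict (Set.Ioo 0 1)

/-- `T r = log (r!) - r * H_r`. -/
def T (r : ℕ) : ℝ := Real.log (Nat.factorial r) - r * (harmonic r : ℝ)

theorem klDiv_map_embedding {α β : Type*} [MeasurableSpace α] [MeasurableSpace β] {f : α → β}
    (hf : MeasurableEmbedding f) (P Q : Measure α) [SigmaFinite P] [SigmaFinite Q] :
    klDiv (P.map f) (Q.map f) = klDiv P Q := by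
  unfold klDiv
  have hiff : P.map f ≪ Q.map f ↔ P ≪ Q := by
    refine ⟨fun h => ?_, hf.absolutelyContinuous_map⟩
    refine Measure.AbsolutelyContinuous.mk fun s _ hs0 => ?_
    have h1 : (Q.map f) (f '' s) = 0 := by
      rw [hf.map_apply, hf.injective.preimage_image, hs0]
    have h2 := h h1
    rwa [hf.map_apply, hf.injective.preimage_image] at h2
  by_cases h : P ≪ Q
  · rw [if_pos (hiff.2 h), if_pos h, hf.integral_map]
    congr 1
    refine integral_congr_ae ?_
    filter_upwards [h.ae_le (hf.rnDeriv_map P Q)] with x hx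
    simp only [hx]
  · rw [if_neg (fun h' => h (hiff.1 h')), if_neg h]

theorem measurable_sortTuple_apply {n : ℕ} (j : Fin n) :
    Measurable fun x : Fin n → ℝ => sortTuple x j := by
  refine measurable_of_Iic fun a => ?_
  have key : (fun x : Fin n → ℝ => sortTuple x j) ⁻¹' Set.Iic a
      = {x | (j : ℕ) < ∑ i, Set.indicator (Set.Iic a) (fun _ => (1 : ℕ)) (x i)} := by
    ext x
    have h := Tuple.lt_card_le_iff_apply_le_of_monotone (j := j) (a := a)
      (Tuple.monotone_sort x)
    rw [Set.mem_preimage, Set.mem_Iic, sortTuple, ← h, Set.mem_ofPred_eq, Finset.card_filter,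
      ← Equiv.sum_comp (Tuple.sort x)
        (fun i => Set.indicator (Set.Iic a) (fun _ => (1 : ℕ)) (x i))]
    simp [Set.indicator_apply]
  rw [key]
  refine measurableSet_lt measurable_const ?_
  refine Finset.measurable_sum _ fun i _ => ?_
  exact (measurable_const.indicator measurableSet_Iic).comp (measurable_pi_apply i)

theorem sortTuple_comp {n : ℕ} {F : ℝ → ℝ} (hF : Monotone F) (x : Fin n → ℝ) :
    sortTuple (fun i => F (x i)) = fun i => F (sortTuple x i) := by
  have h : Monotone ((fun i => F (x i)) ∘ Tuple.sort x) :=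
    hF.comp (Tuple.monotone_sort x)
  exact (Tuple.comp_sort_eq_comp_iff_monotone.2 h).symm

theorem map_cdf_eq_unif (μ : Measure ℝ) [IsProbabilityMeasure μ]
    (hF : Continuous fun x => (μ (Set.Iic x)).toReal)
    (hFmono : StrictMono fun x => (μ (Set.Iic x)).toReal)
    (hFrange : Set.range (fun x => (μ (Set.Iic x)).toReal) = Set.Ioo 0 1) :
    μ.map (fun x => (μ (Set.Iic x)).toReal) = unif := by
  have hmem : ∀ x, (μ (Set.Iic x)).toReal ∈ Set.Ioo (0 : ℝ) 1 := fun x => by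
    rw [← hFrange]; exact ⟨x, rfl⟩
  have : IsProbabilityMeasure (μ.map (fun x => (μ (Set.Iic x)).toReal)) :=
    Measure.isProbabilityMeasure_map hF.measurable.aemeasurable
  refine Measure.ext_of_Iic _ _ fun a => ?_
  rw [Measure.map_apply hF.measurable measurableSet_Iic, unif,
    Measure.restrict_apply measurableSet_Iic]
  rcases le_or_gt a 0 with ha | ha
  · have h1 : (fun x => (μ (Set.Iic x)).toReal) ⁻¹' Set.Iic a = ∅ := by
      ext x
      simp only [Set.mem_preimage, Set.mem_Iic, Set.mem_empty_iff_false, iff_false, not_le]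
      exact ha.trans_lt (hmem x).1
    have h2 : Set.Iic a ∩ Set.Ioo 0 1 = ∅ := by
      ext x
      simp only [Set.mem_inter_iff, Set.mem_Iic, Set.mem_Ioo, Set.mem_empty_iff_false, iff_false]
      rintro ⟨h, h', _⟩
      linarith
    rw [h1, h2]; simp
  rcases le_or_gt 1 a with ha1 | ha1
  · have h1 : (fun x => (μ (Set.Iic x)).toReal) ⁻¹' Set.Iic a = Set.univ := by
      ext x
      simp only [Set.mem_preimage, Set.mem_Iic, Set.mem_univ, iff_true]
      exact (hmem x).2.le.trans ha1
    have h2 : Set.Iic a ∩ Set.Ioo 0 1 = Set.Ioo 0 1 := by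
      refine Set.inter_eq_right.2 fun x hx => hx.2.le.trans ha1
    rw [h1, h2]; simp
  · have hr : a ∈ Set.range (fun x => (μ (Set.Iic x)).toReal) := by
      rw [hFrange]; exact ⟨ha, ha1⟩
    obtain ⟨x₀, hx₀⟩ := hr
    have h1 : (fun x => (μ (Set.Iic x)).toReal) ⁻¹' Set.Iic a = Set.Iic x₀ := by
      ext x
      rw [← hx₀]
      exact hFmono.le_iff_le
    have h2 : Set.Iic a ∩ Set.Ioo 0 1 = Set.Ioc 0 a := by
      ext x
      simp only [Set.mem_inter_iff, Set.mem_Iic, Set.mem_Ioo, Set.mem_Ioc]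
      constructor
      · rintro ⟨h, h', _⟩; exact ⟨h', h⟩
      · rintro ⟨h, h'⟩; exact ⟨h', h, h'.trans_lt ha1⟩
    rw [h1, h2, Real.volume_Ioc, sub_zero, ← hx₀, ENNReal.ofReal_toReal (measure_ne_top _ _)]

theorem miTuples_map (n : ℕ) (μ : Measure ℝ) [IsProbabilityMeasure μ] {F : ℝ → ℝ}
    (hm : Measurable F) (hF : StrictMono F) (I₁ I₂ : Finset (Fin n)) :
    miTuples n (μ.map F) I₁ I₂ = miTuples n μ I₁ I₂ := by
  have : IsProbabilityMeasure (μ.map F) := Measure.isProbabilityMeasure_map hm.aemeasurable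
  have hpi : Measurable fun (x : Fin n → ℝ) i => F (x i) :=
    measurable_pi_lambda _ fun i => hm.comp (measurable_pi_apply i)
  have hsample : sampleLaw n (μ.map F) = (sampleLaw n μ).map fun x i => F (x i) := by
    unfold sampleLaw
    exact (Measure.pi_map_pi fun _ => hm.aemeasurable).symm
  have : IsProbabilityMeasure (sampleLaw n μ) := by unfold sampleLaw; infer_instance
  have hsort : ∀ I : Finset (Fin n),
      Measurable fun (x : Fin n → ℝ) (i : I) => sortTuple x i.1 := fun I =>
    measurable_pi_lambda _ fun i => measurable_sortTuple_apply i.1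
  have hG : ∀ I : Finset (Fin n), Measurable fun (y : I → ℝ) i => F (y i) := fun I =>
    measurable_pi_lambda _ fun i => hm.comp (measurable_pi_apply i)
  have hGi : ∀ I : Finset (Fin n), Function.Injective fun (y : I → ℝ) i => F (y i) :=
    fun I y z h => funext fun i => hF.injective (congrFun h i)
  have horder : ∀ I : Finset (Fin n),
      orderLaw n (μ.map F) I = (orderLaw n μ I).map fun y i => F (y i) := fun I => by
    unfold orderLaw
    rw [hsample, Measure.map_map (hsort I) hpi, Measure.map_map (hG I) (hsort I)]
    congr 1
    funext x i
    exact congrFun (sortTuple_comp hF.monotone x) i.1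
  have : ∀ I : Finset (Fin n), IsProbabilityMeasure (orderLaw n μ I) := fun I =>
    Measure.isProbabilityMeasure_map (hsort I).aemeasurable
  have hemb : MeasurableEmbedding (Prod.map (fun (y : I₁ → ℝ) i => F (y i))
      (fun (y : I₂ → ℝ) i => F (y i))) :=
    ((hG I₁).prodMap (hG I₂)).measurableEmbedding ((hGi I₁).prodMap (hGi I₂))
  have hpair : Measurable fun x : Fin n → ℝ =>
      ((fun i : I₁ => sortTuple x i.1), (fun i : I₂ => sortTuple x i.1)) :=
    (hsort I₁).prodMk (hsort I₂)
  have : IsProbabilityMeasure ((sampleLaw n μ).map fun x : Fin n → ℝ =>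
      ((fun i : I₁ => sortTuple x i.1), (fun i : I₂ => sortTuple x i.1))) :=
    Measure.isProbabilityMeasure_map hpair.aemeasurable
  unfold miTuples
  rw [horder, horder, Measure.map_prod_map _ _ (hG I₁) (hG I₂), ← klDiv_map_embedding hemb
      ((sampleLaw n μ).map fun x : Fin n → ℝ =>
        ((fun i : I₁ => sortTuple x i.1), (fun i : I₂ => sortTuple x i.1))),
    hsample, Measure.map_map hpair hpi, Measure.map_map hemb.measurable hpair]
  congr 2
  funext x
  simp only [Function.comp_apply, Prod.map_apply, sortTuple_comp hF.monotone x]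

/-- Distribution-free property of the mutual information between two tuples of order
statistics, for sampling distributions with an invertible cdf. -/
theorem mutualInfo_orderStatistics_distribution_free
    (n : ℕ) (hn : 0 < n) (μ : Measure ℝ) [IsProbabilityMeasure μ]
    (hF : Continuous fun x => (μ (Set.Iic x)).toReal)
    (hFmono : StrictMono fun x => (μ (Set.Iic x)).toReal)
    (hFrange : Set.range (fun x => (μ (Set.Iic x)).toReal) = Set.Ioo 0 1)
    (I₁ I₂ : Finset (Fin n)) :
    miTuples n μ I₁ I₂ = miTuples n unif I₁ I₂ := by
  rw [← map_cdf_eq_unif μ hF hFmono hFrange, miTuples_map n μ hF.measurable hFmono]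
end
end

section
/- Let n be a positive integer, let μ be a probability measure on ℝ whose cumulative distribution function is continuous and strictly increasing with range (0,1), and let X_1,...,X_n be i.i.d. with law μ. Then for all integers 1 ≤ r < m ≤ n, the mutual information between the r-th and m-th order statistics satisfies I(X_(r); X_(m)) = T_{m−1} + T_{n−r} − T_{m−r−1} − T_n. -/
open MeasureTheory Real Filter Topology Classical

noncomputable section

lemma beta_nat (a b : ℕ) (L : ℝ) :
    ∫ x in (0:ℝ)..L, x ^ a * (L - x) ^ b
      = (a.factorial * b.factorial / (a + b + 1).factorial : ℝ) * L ^ (a + b + 1) := by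
  induction b generalizing a with
  | zero =>
    simp only [pow_zero, mul_one, integral_pow, add_zero, Nat.factorial_zero, Nat.cast_one,
      Nat.factorial_succ]
    have : (a.factorial : ℝ) ≠ 0 := by exact_mod_cast a.factorial_ne_zero
    have h2 : (a : ℝ) + 1 ≠ 0 := by positivity
    push_cast
    field_simp
    simp
  | succ b ih =>
    have h : ∀ x : ℝ, x ^ a * (L - x) ^ (b + 1)
        = L * (x ^ a * (L - x) ^ b) - x ^ (a + 1) * (L - x) ^ b := by
      intro x; ring
    simp only [h]
    rw [intervalIntegral.integral_sub, intervalIntegral.integral_const_mul, ih a, ih (a + 1)]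
    · have e1 : a + 1 + b + 1 = (a + b + 1) + 1 := by ring
      have e2 : a + (b + 1) + 1 = (a + b + 1) + 1 := by ring
      rw [e1, e2, Nat.factorial_succ (a + b + 1), Nat.factorial_succ a, Nat.factorial_succ b]
      have h1 : ((a + b + 1).factorial : ℝ) ≠ 0 := by exact_mod_cast Nat.factorial_ne_zero _
      have h2 : (a : ℝ) + b + 1 + 1 ≠ 0 := by positivity
      push_cast
      field_simp
      ring
    · exact Continuous.intervalIntegrable (by fun_prop) _ _
    · exact Continuous.intervalIntegrable (by fun_prop) _ _

lemma logpow_intervalIntegrable (f : ℝ → ℝ) (hf : Continuous f) :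
    IntervalIntegrable (fun x : ℝ => f x * Real.log x) volume 0 1 :=
  intervalIntegral.intervalIntegrable_log'.continuousOn_mul hf.continuousOn

lemma pow_log (a : ℕ) :
    ∫ x in (0:ℝ)..1, x ^ a * Real.log x = - (1 / ((a:ℝ) + 1) ^ 2) := by
  have ha : (a : ℝ) + 1 ≠ 0 := by positivity
  have := intervalIntegral.integral_eq_sub_of_hasDerivAt_of_le (a := (0:ℝ)) (b := 1)
    (f := fun x => x ^ a * (x * Real.log x) / (a + 1) - x ^ (a + 1) / ((a : ℝ) + 1) ^ 2)
    (f' := fun x => x ^ a * Real.log x) zero_le_one ?_ ?_ ?_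
  · rw [this]; simp
  · have := Real.continuous_mul_log
    exact Continuous.continuousOn (by fun_prop)
  · intro x hx
    have hx0 : x ≠ 0 := hx.1.ne'
    have h1 : HasDerivAt (fun x : ℝ => x ^ (a + 1) * Real.log x / (a + 1)
        - x ^ (a + 1) / ((a : ℝ) + 1) ^ 2)
        ((((a + 1 : ℕ) : ℝ) * x ^ a * Real.log x + x ^ (a + 1) * x⁻¹) / (a + 1)
          - (((a + 1 : ℕ) : ℝ) * x ^ a) / ((a : ℝ) + 1) ^ 2) x :=
      (((hasDerivAt_pow (a + 1) x).mul (Real.hasDerivAt_log hx0)).div_const _).sub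
        ((hasDerivAt_pow (a + 1) x).div_const _)
    have e1 : (fun x : ℝ => x ^ a * (x * Real.log x) / (a + 1) - x ^ (a + 1) / ((a : ℝ) + 1) ^ 2)
        = fun x : ℝ => x ^ (a + 1) * Real.log x / (a + 1) - x ^ (a + 1) / ((a : ℝ) + 1) ^ 2 := by
      funext y; ring
    have e2 : x ^ a * Real.log x = (((a + 1 : ℕ) : ℝ) * x ^ a * Real.log x + x ^ (a + 1) * x⁻¹)
        / (a + 1) - (((a + 1 : ℕ) : ℝ) * x ^ a) / ((a : ℝ) + 1) ^ 2 := by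
      push_cast; field_simp; ring
    rw [e1, e2]; exact h1
  · exact logpow_intervalIntegrable _ (by fun_prop)

lemma beta_log (a b : ℕ) :
    ∫ x in (0:ℝ)..1, x ^ a * (1 - x) ^ b * Real.log x
      = (a.factorial * b.factorial / (a + b + 1).factorial : ℝ)
        * ((harmonic a : ℝ) - harmonic (a + b + 1)) := by
  induction b generalizing a with
  | zero =>
    simp only [pow_zero, mul_one, pow_log, add_zero, Nat.factorial_zero, Nat.cast_one,
      Nat.factorial_succ, harmonic_succ]
    have : (a.factorial : ℝ) ≠ 0 := by exact_mod_cast a.factorial_ne_zero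
    have h2 : (a : ℝ) + 1 ≠ 0 := by positivity
    push_cast
    field_simp
    ring
  | succ b ih =>
    have h : ∀ x : ℝ, x ^ a * (1 - x) ^ (b + 1) * Real.log x
        = (x ^ a * (1 - x) ^ b) * Real.log x - x ^ (a + 1) * (1 - x) ^ b * Real.log x := by
      intro x; ring
    simp only [h]
    rw [intervalIntegral.integral_sub, ih a, ih (a + 1)]
    · have e1 : a + 1 + b + 1 = (a + b + 1) + 1 := by ring
      have e2 : a + (b + 1) + 1 = (a + b + 1) + 1 := by ring
      rw [e1, e2, Nat.factorial_succ (a + b + 1), Nat.factorial_succ a, Nat.factorial_succ b,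
        harmonic_succ (a + b + 1), harmonic_succ a]
      have h1 : ((a + b + 1).factorial : ℝ) ≠ 0 := by exact_mod_cast Nat.factorial_ne_zero _
      have h2 : (a : ℝ) + b + 1 + 1 ≠ 0 := by positivity
      have h3 : (a : ℝ) + 1 ≠ 0 := by positivity
      push_cast
      field_simp
      ring
    · exact logpow_intervalIntegrable _ (by fun_prop)
    · exact logpow_intervalIntegrable _ (by fun_prop)

/-- unnormalised joint density of a pair of uniform order statistics -/
def GG (p q s : ℕ) (u v : ℝ) : ENNReal :=
  if u < v then ENNReal.ofReal (u ^ p * (v - u) ^ q * (1 - v) ^ s) else 0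

lemma measurable_GG (p q s : ℕ) : Measurable fun z : ℝ × ℝ => GG p q s z.1 z.2 := by
  unfold GG
  refine Measurable.ite (measurableSet_lt measurable_fst measurable_snd) ?_ measurable_const
  exact ENNReal.measurable_ofReal.comp (by fun_prop)

lemma lint_Ioo (f : ℝ → ℝ) (hf : Continuous f) (a b : ℝ) (hab : a ≤ b)
    (h0 : ∀ x ∈ Set.Ioo a b, 0 ≤ f x) :
    ∫⁻ x in Set.Ioo a b, ENNReal.ofReal (f x) = ENNReal.ofReal (∫ x in a..b, f x) := by
  rw [intervalIntegral.integral_of_le hab, integral_Ioc_eq_integral_Ioo]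
  refine (ofReal_integral_eq_lintegral_ofReal ?_ ?_).symm
  · exact (hf.integrableOn_Icc).mono_set Set.Ioo_subset_Icc_self
  · exact (ae_restrict_iff' measurableSet_Ioo).2 (ae_of_all _ h0)

lemma GG_marg1 (p q s : ℕ) (u : ℝ) (hu : u ∈ Set.Ioo (0:ℝ) 1) :
    ∫⁻ v, GG p q s u v ∂unif
      = ENNReal.ofReal ((q.factorial * s.factorial / (q + s + 1).factorial : ℝ)
          * (u ^ p * (1 - u) ^ (q + s + 1))) := by
  have h1 : ∀ v, GG p q s u v
      = (Set.Ioi u).indicator (fun v => ENNReal.ofReal (u ^ p * (v - u) ^ q * (1 - v) ^ s)) v := by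
    intro v; simp [GG, Set.indicator_apply]
  simp only [h1, unif]
  rw [lintegral_indicator measurableSet_Ioi, Measure.restrict_restrict measurableSet_Ioi]
  have h2 : Set.Ioi u ∩ Set.Ioo 0 1 = Set.Ioo u 1 := by
    ext x; simp only [Set.mem_inter_iff, Set.mem_Ioi, Set.mem_Ioo]
    constructor
    · rintro ⟨h, _, h'⟩; exact ⟨h, h'⟩
    · rintro ⟨h, h'⟩; exact ⟨h, hu.1.trans h, h'⟩
  rw [h2, lint_Ioo _ (by fun_prop) _ _ hu.2.le]
  · congr 1
    have h3 : ∀ v : ℝ, u ^ p * (v - u) ^ q * (1 - v) ^ s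
        = u ^ p * ((fun x => x ^ q * ((1 - u) - x) ^ s) (v - u)) := by
      intro v; simp only []; rw [show 1 - u - (v - u) = 1 - v by ring]; ring
    simp only [h3]
    rw [intervalIntegral.integral_const_mul, intervalIntegral.integral_comp_sub_right
      (fun x => x ^ q * ((1 - u) - x) ^ s) u, sub_self, beta_nat]
    ring
  · intro v hv
    have := hu.1
    have h1 : 0 ≤ v - u := by linarith [hv.1]
    have h2 : 0 ≤ 1 - v := by linarith [hv.2]
    positivity

lemma GG_marg2 (p q s : ℕ) (v : ℝ) (hv : v ∈ Set.Ioo (0:ℝ) 1) :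
    ∫⁻ u, GG p q s u v ∂unif
      = ENNReal.ofReal ((p.factorial * q.factorial / (p + q + 1).factorial : ℝ)
          * (v ^ (p + q + 1) * (1 - v) ^ s)) := by
  have h1 : ∀ u, GG p q s u v
      = (Set.Iio v).indicator (fun u => ENNReal.ofReal (u ^ p * (v - u) ^ q * (1 - v) ^ s)) u := by
    intro u; simp [GG, Set.indicator_apply]
  simp only [h1, unif]
  rw [lintegral_indicator measurableSet_Iio, Measure.restrict_restrict measurableSet_Iio]
  have h2 : Set.Iio v ∩ Set.Ioo 0 1 = Set.Ioo 0 v := by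
    ext x; simp only [Set.mem_inter_iff, Set.mem_Iio, Set.mem_Ioo]
    constructor
    · rintro ⟨h, h', _⟩; exact ⟨h', h⟩
    · rintro ⟨h, h'⟩; exact ⟨h', h, h'.trans hv.2⟩
  rw [h2, lint_Ioo _ (by fun_prop) _ _ hv.1.le]
  · congr 1
    rw [intervalIntegral.integral_mul_const, beta_nat]
    ring
  · intro u hu
    have := hu.1
    have h1 : 0 ≤ v - u := by linarith [hu.2]
    have h2 : 0 ≤ 1 - v := by linarith [hv.2]
    positivity

/-- Reflection `u ↦ v - u` swaps the first two parameters. -/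
lemma GG_swap (p q s : ℕ) (φ : ℝ → ENNReal) (v : ℝ) (hv : v ∈ Set.Ioo (0:ℝ) 1) :
    ∫⁻ u, GG p q s u v * φ (v - u) ∂unif = ∫⁻ u, GG q p s u v * φ u ∂unif := by
  unfold unif
  rw [← lintegral_indicator measurableSet_Ioo, ← lintegral_indicator measurableSet_Ioo,
    ← lintegral_sub_left_eq_self _ v]
  refine lintegral_congr fun u => ?_
  simp only [Set.indicator_apply, GG, Set.mem_Ioo, sub_sub_cancel]
  have := hv.2
  by_cases h1 : 0 < u
  · by_cases h2 : u < v
    · have a1 : 0 < v - u ∧ v - u < 1 := ⟨by linarith, by linarith⟩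
      have a2 : 0 < u ∧ u < 1 := ⟨by linarith, by linarith⟩
      rw [if_pos a1, if_pos a2, if_pos h2, if_pos (by linarith : v - u < v)]
      congr 2; ring
    · have a1 : ¬ (0 < v - u ∧ v - u < 1) := by rintro ⟨h, -⟩; linarith
      rw [if_neg a1, if_neg h2]; simp
  · have a1 : ¬ (v - u < v) := by linarith
    have a2 : ¬ (0 < u ∧ u < 1) := by tauto
    rw [if_neg a1, if_neg a2]; simp

instance : IsProbabilityMeasure unif := ⟨by simp [unif]⟩

/-- beta density with integer parameters -/
def bd (a b : ℕ) (u : ℝ) : ENNReal :=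
  ENNReal.ofReal (((a + b + 1).factorial / (a.factorial * b.factorial) : ℝ) * (u ^ a * (1 - u) ^ b))

lemma measurable_bd (a b : ℕ) : Measurable (bd a b) :=
  ENNReal.measurable_ofReal.comp (by fun_prop)

def betaM (a b : ℕ) : Measure ℝ := unif.withDensity (bd a b)

lemma bd_nonneg (a b : ℕ) {u : ℝ} (hu : u ∈ Set.Ioo (0:ℝ) 1) :
    0 < ((a + b + 1).factorial / (a.factorial * b.factorial) : ℝ) * (u ^ a * (1 - u) ^ b) := by
  have h1 := hu.1
  have h2 : 0 < 1 - u := by linarith [hu.2]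
  have := a.factorial_pos
  have := b.factorial_pos
  have := (a + b + 1).factorial_pos
  positivity

lemma betaM_integral (a b : ℕ) (f : ℝ → ℝ)
    (hf : IntervalIntegrable (fun x => x ^ a * (1 - x) ^ b * f x) volume 0 1) :
    Integrable f (betaM a b) ∧ ∫ x, f x ∂(betaM a b)
      = ((a + b + 1).factorial / (a.factorial * b.factorial) : ℝ)
        * ∫ x in (0:ℝ)..1, x ^ a * (1 - x) ^ b * f x := by
  have hfin : ∀ᵐ x ∂unif, bd a b x < ⊤ := ae_of_all _ fun x => ENNReal.ofReal_lt_top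
  have hae : ∀ᵐ x ∂unif, (bd a b x).toReal * f x
      = ((a + b + 1).factorial / (a.factorial * b.factorial) : ℝ)
        * (x ^ a * (1 - x) ^ b * f x) := by
    refine (ae_restrict_iff' measurableSet_Ioo).2 (ae_of_all _ fun x hx => ?_)
    rw [bd, ENNReal.toReal_ofReal (bd_nonneg a b hx).le]; ring
  constructor
  · rw [betaM, integrable_withDensity_iff (measurable_bd a b) hfin]
    have h1 : Integrable (fun x => x ^ a * (1 - x) ^ b * f x) unif := by
      rw [intervalIntegrable_iff_integrableOn_Ioo_of_le zero_le_one] at hf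
      exact hf
    refine (h1.const_mul ((a + b + 1).factorial / (a.factorial * b.factorial) : ℝ)).congr ?_
    filter_upwards [hae] with x hx
    rw [← hx, mul_comm]
  · rw [betaM, integral_withDensity_eq_integral_toReal_smul (measurable_bd a b) hfin]
    simp only [smul_eq_mul]
    rw [integral_congr_ae hae, integral_const_mul, intervalIntegral.integral_of_le zero_le_one,
      integral_Ioc_eq_integral_Ioo]
    rfl

lemma betaM_log (a b : ℕ) :
    Integrable Real.log (betaM a b) ∧ ∫ x, Real.log x ∂(betaM a b)
      = (harmonic a : ℝ) - harmonic (a + b + 1) := by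
  have h := betaM_integral a b Real.log (logpow_intervalIntegrable _ (by fun_prop))
  refine ⟨h.1, ?_⟩
  rw [h.2, beta_log]
  have h1 : (a.factorial : ℝ) ≠ 0 := by exact_mod_cast Nat.factorial_ne_zero _
  have h2 : (b.factorial : ℝ) ≠ 0 := by exact_mod_cast Nat.factorial_ne_zero _
  have h3 : ((a + b + 1).factorial : ℝ) ≠ 0 := by exact_mod_cast Nat.factorial_ne_zero _
  field_simp

lemma betaM_log_one_sub (a b : ℕ) :
    Integrable (fun x => Real.log (1 - x)) (betaM a b) ∧ ∫ x, Real.log (1 - x) ∂(betaM a b)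
      = (harmonic b : ℝ) - harmonic (a + b + 1) := by
  have e : ∀ x : ℝ, x ^ a * (1 - x) ^ b * Real.log (1 - x)
      = (fun y => y ^ b * (1 - y) ^ a * Real.log y) (1 - x) := by
    intro x; simp only [sub_sub_cancel]; ring
  have hi : IntervalIntegrable (fun y : ℝ => y ^ b * (1 - y) ^ a * Real.log y) volume 0 1 :=
    logpow_intervalIntegrable _ (by fun_prop)
  have h := betaM_integral a b (fun x => Real.log (1 - x)) (by
    simp only [e]
    have := (hi.comp_sub_left 1).symm
    simpa using this)
  refine ⟨h.1, ?_⟩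
  rw [h.2]
  simp only [e]
  rw [intervalIntegral.integral_comp_sub_left (fun y => y ^ b * (1 - y) ^ a * Real.log y) 1]
  rw [sub_self, sub_zero, beta_log, show b + a + 1 = a + b + 1 by ring]
  have h1 : (a.factorial : ℝ) ≠ 0 := by exact_mod_cast Nat.factorial_ne_zero _
  have h2 : (b.factorial : ℝ) ≠ 0 := by exact_mod_cast Nat.factorial_ne_zero _
  have h3 : ((a + b + 1).factorial : ℝ) ≠ 0 := by exact_mod_cast Nat.factorial_ne_zero _
  field_simp

lemma map_fst_wd (μ ν : Measure ℝ) [SFinite μ] [SFinite ν] (g : ℝ × ℝ → ENNReal)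
    (hg : Measurable g) :
    ((μ.prod ν).withDensity g).map Prod.fst = μ.withDensity fun a => ∫⁻ b, g (a, b) ∂ν := by
  ext A hA
  rw [Measure.map_apply measurable_fst hA, withDensity_apply _ (measurable_fst hA),
    withDensity_apply _ hA, ← lintegral_indicator (measurable_fst hA), ← lintegral_indicator hA,
    lintegral_prod _ ((hg.indicator (measurable_fst hA)).aemeasurable)]
  refine lintegral_congr fun a => ?_
  by_cases h : a ∈ A <;> simp [h]

lemma map_snd_wd (μ ν : Measure ℝ) [SFinite μ] [SFinite ν] (g : ℝ × ℝ → ENNReal)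
    (hg : Measurable g) :
    ((μ.prod ν).withDensity g).map Prod.snd = ν.withDensity fun b => ∫⁻ a, g (a, b) ∂μ := by
  ext A hA
  rw [Measure.map_apply measurable_snd hA, withDensity_apply _ (measurable_snd hA),
    withDensity_apply _ hA, ← lintegral_indicator (measurable_snd hA), ← lintegral_indicator hA,
    lintegral_prod_symm _ ((hg.indicator (measurable_snd hA)).aemeasurable)]
  refine lintegral_congr fun a => ?_
  by_cases h : a ∈ A <;> simp [h]

lemma map_wd_comp {α β : Type*} [MeasurableSpace α] [MeasurableSpace β] (μ : Measure α)
    (f : α → β) (hf : Measurable f) (g : β → ENNReal) (hg : Measurable g) :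
    (μ.withDensity fun x => g (f x)).map f = (μ.map f).withDensity g := by
  ext A hA
  rw [Measure.map_apply hf hA, withDensity_apply _ (hf hA), withDensity_apply _ hA,
    setLIntegral_map hA hg hf]

/-- normalising constant -/
def KK (p q s : ℕ) : ℝ :=
  (p + q + s + 2).factorial / (p.factorial * q.factorial * s.factorial)

lemma KK_pos (p q s : ℕ) : 0 < KK p q s := by
  have := p.factorial_pos
  have := q.factorial_pos
  have := s.factorial_pos
  have := (p + q + s + 2).factorial_pos
  unfold KK; positivity

/-- normalised joint density -/
def hd (p q s : ℕ) (z : ℝ × ℝ) : ENNReal := ENNReal.ofReal (KK p q s) * GG p q s z.1 z.2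

lemma measurable_hd (p q s : ℕ) : Measurable (hd p q s) := (measurable_GG p q s).const_mul _

lemma hd_marg1 (p q s : ℕ) (u : ℝ) (hu : u ∈ Set.Ioo (0:ℝ) 1) :
    ∫⁻ v, hd p q s (u, v) ∂unif = bd p (q + s + 1) u := by
  unfold hd
  have hm : Measurable fun v => GG p q s u v :=
    (measurable_GG p q s).comp (by fun_prop : Measurable fun v => (u, v))
  rw [lintegral_const_mul _ hm,
    GG_marg1 p q s u hu, ← ENNReal.ofReal_mul (KK_pos p q s).le, bd]
  congr 1
  unfold KK
  have h1 : (p.factorial : ℝ) ≠ 0 := by exact_mod_cast Nat.factorial_ne_zero _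
  have h2 : (q.factorial : ℝ) ≠ 0 := by exact_mod_cast Nat.factorial_ne_zero _
  have h3 : (s.factorial : ℝ) ≠ 0 := by exact_mod_cast Nat.factorial_ne_zero _
  have h4 : ((q + s + 1).factorial : ℝ) ≠ 0 := by exact_mod_cast Nat.factorial_ne_zero _
  rw [show p + (q + s + 1) + 1 = p + q + s + 2 by ring]
  field_simp

lemma hd_marg2 (p q s : ℕ) (v : ℝ) (hv : v ∈ Set.Ioo (0:ℝ) 1) :
    ∫⁻ u, hd p q s (u, v) ∂unif = bd (p + q + 1) s v := by
  unfold hd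
  have hm : Measurable fun u => GG p q s u v :=
    (measurable_GG p q s).comp (by fun_prop : Measurable fun u => (u, v))
  rw [lintegral_const_mul _ hm,
    GG_marg2 p q s v hv, ← ENNReal.ofReal_mul (KK_pos p q s).le, bd]
  congr 1
  unfold KK
  have h1 : (p.factorial : ℝ) ≠ 0 := by exact_mod_cast Nat.factorial_ne_zero _
  have h2 : (q.factorial : ℝ) ≠ 0 := by exact_mod_cast Nat.factorial_ne_zero _
  have h3 : (s.factorial : ℝ) ≠ 0 := by exact_mod_cast Nat.factorial_ne_zero _
  have h4 : ((p + q + 1).factorial : ℝ) ≠ 0 := by exact_mod_cast Nat.factorial_ne_zero _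
  rw [show (p + q + 1) + s + 1 = p + q + s + 2 by ring]
  field_simp

lemma ae_unif : ∀ᵐ u ∂unif, u ∈ Set.Ioo (0:ℝ) 1 := ae_restrict_mem measurableSet_Ioo

lemma bd_mass (a b : ℕ) : ∫⁻ u, bd a b u ∂unif = 1 := by
  unfold unif bd
  rw [lint_Ioo _ (by fun_prop) _ _ zero_le_one fun x hx => (bd_nonneg a b hx).le,
    intervalIntegral.integral_const_mul, beta_nat]
  have h1 : (a.factorial : ℝ) ≠ 0 := by exact_mod_cast Nat.factorial_ne_zero _
  have h2 : (b.factorial : ℝ) ≠ 0 := by exact_mod_cast Nat.factorial_ne_zero _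
  have h3 : ((a + b + 1).factorial : ℝ) ≠ 0 := by exact_mod_cast Nat.factorial_ne_zero _
  rw [← ENNReal.ofReal_one]
  congr 1
  field_simp
  simp

/-- joint law of uniform order statistics -/
def U2 (p q s : ℕ) : Measure (ℝ × ℝ) := (unif.prod unif).withDensity (hd p q s)

lemma U2_fst (p q s : ℕ) : (U2 p q s).map Prod.fst = betaM p (q + s + 1) := by
  rw [U2, map_fst_wd _ _ _ (measurable_hd p q s), betaM]
  refine withDensity_congr_ae ?_
  filter_upwards [ae_unif] with u hu using hd_marg1 p q s u hu

lemma U2_snd (p q s : ℕ) : (U2 p q s).map Prod.snd = betaM (p + q + 1) s := by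
  rw [U2, map_snd_wd _ _ _ (measurable_hd p q s), betaM]
  refine withDensity_congr_ae ?_
  filter_upwards [ae_unif] with u hu using hd_marg2 p q s u hu

lemma KK_swap (p q s : ℕ) : KK p q s = KK q p s := by
  unfold KK; rw [show q + p + s + 2 = p + q + s + 2 by ring, mul_comm (q.factorial : ℝ)]

lemma U2_sub (p q s : ℕ) :
    (U2 p q s).map (fun z => z.2 - z.1) = betaM q (p + s + 1) := by
  rw [← U2_fst q p s]
  have hm : Measurable (fun z : ℝ × ℝ => z.2 - z.1) := by fun_prop
  ext A hA
  rw [Measure.map_apply hm hA, Measure.map_apply measurable_fst hA, U2, U2,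
    withDensity_apply _ (hm hA), withDensity_apply _ (measurable_fst hA),
    ← lintegral_indicator (hm hA), ← lintegral_indicator (measurable_fst hA),
    lintegral_prod_symm _ (((measurable_hd p q s).indicator (hm hA)).aemeasurable),
    lintegral_prod_symm _ (((measurable_hd q p s).indicator (measurable_fst hA)).aemeasurable)]
  refine lintegral_congr_ae ?_
  filter_upwards [ae_unif] with v hv
  have := GG_swap p q s (fun w => ENNReal.ofReal (KK p q s) * A.indicator 1 w) v hv
  convert this using 1
  · refine lintegral_congr fun u => ?_
    by_cases h : v - u ∈ A <;> simp [h, hd, mul_comm]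
  · refine lintegral_congr fun u => ?_
    by_cases h : u ∈ A <;> simp [h, hd, mul_comm, KK_swap p q s]


/-- cdf -/
def cF (μ : Measure ℝ) (x : ℝ) : ℝ := (μ (Set.Iic x)).toReal

lemma map_cF (μ : Measure ℝ) [IsProbabilityMeasure μ] (hF : Continuous (cF μ))
    (hmono : StrictMono (cF μ)) (hr : Set.range (cF μ) = Set.Ioo 0 1) : μ.map (cF μ) = unif := by
  have hin : ∀ x, cF μ x ∈ Set.Ioo (0:ℝ) 1 := fun x => hr ▸ Set.mem_range_self x
  have : IsProbabilityMeasure (μ.map (cF μ)) :=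
    Measure.isProbabilityMeasure_map hF.measurable.aemeasurable
  refine Measure.ext_of_Iic _ _ fun t => ?_
  rw [Measure.map_apply hF.measurable measurableSet_Iic, unif,
    Measure.restrict_apply measurableSet_Iic]
  rcases le_or_gt t 0 with h0 | h0
  · have e1 : cF μ ⁻¹' Set.Iic t = ∅ := by
      ext x; have := (hin x).1
      simp only [Set.mem_preimage, Set.mem_Iic, Set.mem_empty_iff_false, iff_false]; linarith
    have e2 : Set.Iic t ∩ Set.Ioo 0 1 = ∅ := by
      ext x
      simp only [Set.mem_inter_iff, Set.mem_Iic, Set.mem_Ioo, Set.mem_empty_iff_false, iff_false]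
      rintro ⟨h, h', _⟩; linarith
    rw [e1, e2]; simp
  · rcases le_or_gt 1 t with h1 | h1
    · have e1 : cF μ ⁻¹' Set.Iic t = Set.univ := by
        ext x; have := (hin x).2
        simp only [Set.mem_preimage, Set.mem_Iic, Set.mem_univ, iff_true]; linarith
      have e2 : Set.Iic t ∩ Set.Ioo 0 1 = Set.Ioo 0 1 := by
        ext x
        simp only [Set.mem_inter_iff, Set.mem_Iic, Set.mem_Ioo, and_iff_right_iff_imp]
        rintro ⟨h, h'⟩; linarith
      rw [e1, e2]; simp
    · obtain ⟨a, rfl⟩ : t ∈ Set.range (cF μ) := by rw [hr]; exact ⟨h0, h1⟩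
      have e1 : cF μ ⁻¹' Set.Iic (cF μ a) = Set.Iic a := by
        ext x; simp [hmono.le_iff_le]
      have e2 : Set.Iic (cF μ a) ∩ Set.Ioo 0 1 = Set.Ioc 0 (cF μ a) := by
        ext x
        simp only [Set.mem_inter_iff, Set.mem_Iic, Set.mem_Ioo, Set.mem_Ioc]
        constructor
        · rintro ⟨h, h', _⟩; exact ⟨h', h⟩
        · rintro ⟨h, h'⟩; exact ⟨h', h, by linarith⟩
      rw [e1, e2, Real.volume_Ioc, sub_zero, cF, ENNReal.ofReal_toReal (measure_ne_top _ _)]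

lemma cF_facts (μ : Measure ℝ) [IsProbabilityMeasure μ] (hF : Continuous (cF μ))
    (hmono : StrictMono (cF μ)) (hr : Set.range (cF μ) = Set.Ioo 0 1) :
    (∀ a, μ {a} = 0) ∧ (∀ a, μ (Set.Iio a) = ENNReal.ofReal (cF μ a)) ∧
    (∀ a, μ (Set.Ioi a) = ENNReal.ofReal (1 - cF μ a)) ∧
    (∀ a b, μ (Set.Ioo a b) = ENNReal.ofReal (cF μ b - cF μ a)) := by
  have hin : ∀ x, cF μ x ∈ Set.Ioo (0:ℝ) 1 := fun x => hr ▸ Set.mem_range_self x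
  have hmap := map_cF μ hF hmono hr
  have key : ∀ S : Set ℝ, MeasurableSet S → μ (cF μ ⁻¹' S) = unif S := fun S hS => by
    rw [← hmap, Measure.map_apply hF.measurable hS]
  refine ⟨fun a => ?_, fun a => ?_, fun a => ?_, fun a b => ?_⟩
  · have e : ({a} : Set ℝ) = cF μ ⁻¹' {cF μ a} := by
      ext x; simp [hmono.injective.eq_iff]
    rw [e, key _ (measurableSet_singleton _), unif,
      Measure.restrict_apply (measurableSet_singleton _)]
    exact measure_mono_null Set.inter_subset_left (by simp)
  · have e : Set.Iio a = cF μ ⁻¹' (Set.Iio (cF μ a)) := by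
      ext x; simp [hmono.lt_iff_lt]
    rw [e, key _ measurableSet_Iio, unif, Measure.restrict_apply measurableSet_Iio]
    have e2 : Set.Iio (cF μ a) ∩ Set.Ioo 0 1 = Set.Ioo 0 (cF μ a) := by
      have := (hin a).2
      ext x
      simp only [Set.mem_inter_iff, Set.mem_Iio, Set.mem_Ioo]
      constructor
      · rintro ⟨h, h', _⟩; exact ⟨h', h⟩
      · rintro ⟨h, h'⟩; exact ⟨h', h, by linarith⟩
    rw [e2, Real.volume_Ioo, sub_zero]
  · have e : Set.Ioi a = cF μ ⁻¹' (Set.Ioi (cF μ a)) := by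
      ext x; simp [hmono.lt_iff_lt]
    rw [e, key _ measurableSet_Ioi, unif, Measure.restrict_apply measurableSet_Ioi]
    have e2 : Set.Ioi (cF μ a) ∩ Set.Ioo 0 1 = Set.Ioo (cF μ a) 1 := by
      have := (hin a).1
      ext x
      simp only [Set.mem_inter_iff, Set.mem_Ioi, Set.mem_Ioo]
      constructor
      · rintro ⟨h, _, h'⟩; exact ⟨h, h'⟩
      · rintro ⟨h, h'⟩; exact ⟨h, by linarith, h'⟩
    rw [e2, Real.volume_Ioo]
  · have e : Set.Ioo a b = cF μ ⁻¹' (Set.Ioo (cF μ a) (cF μ b)) := by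
      ext x; simp [hmono.lt_iff_lt]
    rw [e, key _ measurableSet_Ioo, unif, Measure.restrict_apply measurableSet_Ioo]
    have e2 : Set.Ioo (cF μ a) (cF μ b) ∩ Set.Ioo 0 1 = Set.Ioo (cF μ a) (cF μ b) := by
      have := (hin a).1
      have := (hin b).2
      ext x
      simp only [Set.mem_inter_iff, Set.mem_Ioo, and_iff_left_iff_imp]
      rintro ⟨h, h'⟩; exact ⟨by linarith, by linarith⟩
    rw [e2, Real.volume_Ioo]


/-- `y` is split at positions `r` and `m`. -/
def EE {n : ℕ} {α : Type*} [LinearOrder α] (r m : Fin n) (y : Fin n → α) : Prop :=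
  (∀ k, k < r → y k < y r) ∧ (∀ k, r < k → k < m → y r < y k ∧ y k < y m) ∧
    (∀ k, m < k → y m < y k) ∧ y r < y m

lemma perm_fix {n : ℕ} (ρ : Equiv.Perm (Fin n)) (i : Fin n) (h1 : ∀ k, k < i → ρ k < ρ i)
    (h2 : ∀ k, i < k → ρ i < ρ k) : ρ i = i := by
  have h : (Finset.Iio i).map ρ.toEmbedding = Finset.Iio (ρ i) := by
    ext j
    simp only [Finset.mem_map, Finset.mem_Iio, Equiv.coe_toEmbedding]
    constructor
    · rintro ⟨k, hk, rfl⟩; exact h1 k hk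
    · intro hj
      refine ⟨ρ.symm j, ?_, by simp⟩
      by_contra hc
      rcases (not_lt.1 hc).eq_or_lt with h | h
      · rw [h] at hj; simp at hj
      · have := h2 _ h
        simp only [Equiv.apply_symm_apply] at this
        exact lt_asymm this hj
  have := congrArg Finset.card h
  rw [Finset.card_map, Fin.card_Iio, Fin.card_Iio] at this
  exact Fin.ext this.symm

lemma EE_perm_fix {n : ℕ} (r m : Fin n) (hrm : r < m) (ρ : Equiv.Perm (Fin n))
    (h : EE r m ρ) : ρ r = r ∧ ρ m = m := by
  obtain ⟨h1, h2, h3, h4⟩ := h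
  constructor
  · refine perm_fix ρ r h1 fun k hk => ?_
    rcases lt_trichotomy k m with h | h | h
    · exact (h2 k hk h).1
    · rw [h]; exact h4
    · exact h4.trans (h3 k h)
  · refine perm_fix ρ m (fun k hk => ?_) h3
    rcases lt_trichotomy k r with h | h | h
    · exact (h1 k h).trans h4
    · rw [h]; exact h4
    · exact (h2 k h hk).2

lemma EE_comp {n : ℕ} (r m : Fin n) (s : Fin n → ℝ) (hs : StrictMono s) (ρ : Fin n → Fin n) :
    EE r m (s ∘ ρ) ↔ EE r m ρ := by
  simp [EE, hs.lt_iff_lt]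

/-- number of block-preserving permutations -/
def NN {n : ℕ} (r m : Fin n) : ℕ :=
  (Finset.univ.filter fun ρ : Equiv.Perm (Fin n) => EE r m ρ).card

lemma NN_pos {n : ℕ} (r m : Fin n) (hrm : r < m) : 0 < NN r m := by
  refine Finset.card_pos.2 ⟨1, ?_⟩
  simp only [Finset.mem_filter, Finset.mem_univ, true_and]
  refine ⟨fun k hk => hk, fun k h1 h2 => ⟨h1, h2⟩, fun k hk => hk, hrm⟩

lemma sum_perm {n : ℕ} (r m : Fin n) (hrm : r < m) (x : Fin n → ℝ) (hx : Function.Injective x)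
    (A : Set (ℝ × ℝ)) :
    ∑ σ : Equiv.Perm (Fin n),
      (if EE r m (x ∘ σ) ∧ (x (σ r), x (σ m)) ∈ A then (1 : ENNReal) else 0)
      = NN r m * (if (sortTuple x r, sortTuple x m) ∈ A then 1 else 0) := by
  have hs : StrictMono (sortTuple x) :=
    (Tuple.monotone_sort x).strictMono_of_injective (hx.comp (Tuple.sort x).injective)
  rw [← Equiv.sum_comp (Equiv.mulLeft (Tuple.sort x))]
  have h : ∀ ρ : Equiv.Perm (Fin n),
      (if EE r m (x ∘ (Equiv.mulLeft (Tuple.sort x) ρ)) ∧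
        (x (Equiv.mulLeft (Tuple.sort x) ρ r), x (Equiv.mulLeft (Tuple.sort x) ρ m)) ∈ A
        then (1 : ENNReal) else 0)
      = if EE r m ρ then (if (sortTuple x r, sortTuple x m) ∈ A then 1 else 0) else 0 := by
    intro ρ
    have e : x ∘ (Equiv.mulLeft (Tuple.sort x) ρ) = sortTuple x ∘ ρ := by
      funext k; simp [sortTuple]
    have e' : ∀ k, x (Equiv.mulLeft (Tuple.sort x) ρ k) = sortTuple x (ρ k) := by
      intro k; simp [sortTuple]
    rw [e, e', e', EE_comp r m _ hs]
    by_cases hE : EE r m ρ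
    · obtain ⟨a, b⟩ := EE_perm_fix r m hrm ρ hE
      rw [a, b]; simp [hE]
    · simp [hE]
  rw [Finset.sum_congr rfl fun ρ _ => h ρ, ← Finset.sum_filter, Finset.sum_const, NN,
    nsmul_eq_mul]

lemma measurableSet_EE {n : ℕ} (r m : Fin n) : MeasurableSet {x : Fin n → ℝ | EE r m x} := by
  have hlt : ∀ i j : Fin n, MeasurableSet {x : Fin n → ℝ | x i < x j} := fun i j =>
    measurableSet_lt (measurable_pi_apply i) (measurable_pi_apply j)
  unfold EE
  simp only [Set.ofPred_and, Set.ofPred_forall]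
  refine MeasurableSet.inter ?_ (MeasurableSet.inter ?_ (MeasurableSet.inter ?_ (hlt _ _)))
  · exact MeasurableSet.iInter fun k => MeasurableSet.iInter fun _ => hlt _ _
  · exact MeasurableSet.iInter fun k => MeasurableSet.iInter fun _ =>
      MeasurableSet.iInter fun _ => (hlt _ _).inter (hlt _ _)
  · exact MeasurableSet.iInter fun k => MeasurableSet.iInter fun _ => hlt _ _

lemma measurable_sortTuple {n : ℕ} (i : Fin n) :
    Measurable fun x : Fin n → ℝ => sortTuple x i := by
  have hset : ∀ σ : Equiv.Perm (Fin n), MeasurableSet {x : Fin n → ℝ | σ = Tuple.sort x} := by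
    intro σ
    simp only [Tuple.eq_sort_iff, Monotone, Set.ofPred_and, Set.ofPred_forall]
    refine MeasurableSet.inter ?_ ?_
    · refine MeasurableSet.iInter fun a => MeasurableSet.iInter fun b =>
        MeasurableSet.iInter fun _ => ?_
      exact measurableSet_le (measurable_pi_apply _) (measurable_pi_apply _)
    · refine MeasurableSet.iInter fun a => MeasurableSet.iInter fun b =>
        MeasurableSet.iInter fun _ => ?_
      by_cases h : σ a < σ b
      · simp [h]
      · simp only [h, imp_false]
        have : MeasurableSet {x : Fin n → ℝ | x (σ a) = x (σ b)} :=
          measurableSet_eq_fun (measurable_pi_apply (σ a)) (measurable_pi_apply (σ b))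
        exact this.compl
  intro A hA
  have : (fun x : Fin n → ℝ => sortTuple x i) ⁻¹' A
      = ⋃ σ : Equiv.Perm (Fin n), {x | σ = Tuple.sort x} ∩ {x | x (σ i) ∈ A} := by
    ext x; simp [sortTuple]
  rw [this]
  exact MeasurableSet.iUnion fun σ => (hset σ).inter (measurable_pi_apply (σ i) hA)

lemma pair_law {ι : Type*} [Fintype ι] (μ : Measure ℝ) [IsProbabilityMeasure μ] {i j : ι}
    (hij : i ≠ j) :
    (Measure.pi fun _ : ι => μ).map (fun x => (x i, x j)) = μ.prod μ := by
  have h := (ProbabilityTheory.iIndepFun_pi (μ := fun _ : ι => μ) (X := fun _ => (id : ℝ → ℝ))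
    (fun _ => aemeasurable_id)).indepFun hij
  have h2 := (ProbabilityTheory.indepFun_iff_map_prod_eq_prod_map_map
    (measurable_pi_apply i).aemeasurable (measurable_pi_apply j).aemeasurable).1 h
  refine h2.trans ?_
  congr 1
  · exact (measurePreserving_eval (fun _ : ι => μ) i).map_eq
  · exact (measurePreserving_eval (fun _ : ι => μ) j).map_eq

lemma ae_injective {n : ℕ} (μ : Measure ℝ) [IsProbabilityMeasure μ] (h0 : ∀ a, μ {a} = 0) :
    ∀ᵐ x ∂(sampleLaw n μ), Function.Injective x := by
  have hd : (μ.prod μ) {z | z.1 = z.2} = 0 := by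
    rw [Measure.measure_prod_null (measurableSet_eq_fun measurable_fst measurable_snd)]
    refine ae_of_all _ fun a => ?_
    have : Prod.mk a ⁻¹' {z : ℝ × ℝ | z.1 = z.2} = {a} := by
      ext b; simp [eq_comm]
    change μ (Prod.mk a ⁻¹' {z : ℝ × ℝ | z.1 = z.2}) = 0
    rw [this, h0]
  have h : ∀ i j : Fin n, i ≠ j → ∀ᵐ x ∂(sampleLaw n μ), x i ≠ x j := by
    intro i j hij
    rw [ae_iff]
    simp only [ne_eq, not_not]
    rw [← pair_law μ hij, Measure.map_apply (by fun_prop)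
      (measurableSet_eq_fun measurable_fst measurable_snd)] at hd
    exact hd
  have h' : ∀ᵐ x ∂(sampleLaw n μ), ∀ i j : Fin n, i ≠ j → x i ≠ x j := by
    rw [ae_all_iff]; intro i
    rw [ae_all_iff]; intro j
    by_cases hij : i = j
    · simp [hij]
    · filter_upwards [h i j hij] with x hx _ using hx
  filter_upwards [h'] with x hx i j hij
  by_contra hne
  exact hx i j hne hij

lemma mp_perm {n : ℕ} (μ : Measure ℝ) [IsProbabilityMeasure μ] (σ : Equiv.Perm (Fin n)) :
    MeasurePreserving (fun x : Fin n → ℝ => x ∘ σ) (sampleLaw n μ) (sampleLaw n μ) := by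
  have h := measurePreserving_piCongrLeft (fun _ : Fin n => μ) σ.symm
  have e : (MeasurableEquiv.piCongrLeft (fun _ : Fin n => ℝ) σ.symm : (Fin n → ℝ) → (Fin n → ℝ))
      = fun x => x ∘ σ := by
    funext x i
    have := Equiv.piCongrLeft_apply_apply (fun _ : Fin n => ℝ) σ.symm x (σ i)
    rw [Equiv.symm_apply_apply] at this
    exact this
  rw [e] at h
  exact h

lemma joint_law_EE {n : ℕ} (μ : Measure ℝ) [IsProbabilityMeasure μ] (h0 : ∀ a, μ {a} = 0)
    (r m : Fin n) (hrm : r < m) (A : Set (ℝ × ℝ)) (hA : MeasurableSet A) :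
    (NN r m : ENNReal) * (sampleLaw n μ).map (fun x => (sortTuple x r, sortTuple x m)) A
      = n.factorial * sampleLaw n μ {x | EE r m x ∧ (x r, x m) ∈ A} := by
  have hS : MeasurableSet {x : Fin n → ℝ | EE r m x ∧ (x r, x m) ∈ A} :=
    (measurableSet_EE r m).inter
      ((by fun_prop : Measurable fun x : Fin n → ℝ => (x r, x m)) hA)
  have hm : Measurable (fun x : Fin n → ℝ => (sortTuple x r, sortTuple x m)) :=
    (measurable_sortTuple r).prodMk (measurable_sortTuple m)
  have hσ : ∀ σ : Equiv.Perm (Fin n),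
      ∫⁻ x, (if EE r m (x ∘ σ) ∧ (x (σ r), x (σ m)) ∈ A then (1 : ENNReal) else 0) ∂(sampleLaw n μ)
        = sampleLaw n μ {x | EE r m x ∧ (x r, x m) ∈ A} := by
    intro σ
    rw [← (mp_perm μ σ).measure_preimage hS.nullMeasurableSet,
      ← lintegral_indicator_one ((mp_perm μ σ).measurable hS)]
    refine lintegral_congr fun x => ?_
    simp [Set.indicator_apply]
  have hmeas : ∀ σ : Equiv.Perm (Fin n), Measurable fun x : Fin n → ℝ =>
      (if EE r m (x ∘ σ) ∧ (x (σ r), x (σ m)) ∈ A then (1 : ENNReal) else 0) := by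
    intro σ
    exact Measurable.ite ((mp_perm μ σ).measurable hS) measurable_const measurable_const
  have h1 := lintegral_finsetSum (μ := sampleLaw n μ) Finset.univ (fun σ _ => hmeas σ)
  rw [Finset.sum_congr rfl fun σ _ => hσ σ, Finset.sum_const, Finset.card_univ, Fintype.card_perm,
    Fintype.card_fin, nsmul_eq_mul] at h1
  rw [← h1, Measure.map_apply hm hA, ← lintegral_indicator_one (hm hA),
    ← lintegral_const_mul _ (measurable_one.indicator (hm hA))]
  refine lintegral_congr_ae ?_
  filter_upwards [ae_injective μ h0] with x hx
  rw [sum_perm r m hrm x hx A]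
  simp [Set.indicator_apply]

/-- allowed region for the coordinate `k` -/
def box {n : ℕ} (r m k : Fin n) (a b : ℝ) : Set ℝ :=
  if k < r then Set.Iio a else if k < m then Set.Ioo a b else Set.Ioi b

lemma prod_box {n : ℕ} (μ : Measure ℝ) [IsProbabilityMeasure μ] (hF : Continuous (cF μ))
    (hmono : StrictMono (cF μ)) (hr : Set.range (cF μ) = Set.Ioo 0 1)
    (r m : Fin n) (hrm : r < m) (a b : ℝ) (hab : a < b) :
    ∏ k : {k // ¬ (k = r ∨ k = m)}, μ (box r m k.1 a b)
      = GG r (m - r - 1) (n - 1 - m) (cF μ a) (cF μ b) := by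
  obtain ⟨-, f1, f2, f3⟩ := cF_facts μ hF hmono hr
  have hin : ∀ x, cF μ x ∈ Set.Ioo (0:ℝ) 1 := fun x => hr ▸ Set.mem_range_self x
  have hlt := hmono hab
  rw [← Finset.prod_subtype ((Finset.Iio r ∪ Finset.Ioo r m) ∪ Finset.Ioi m)
    (p := fun k => ¬ (k = r ∨ k = m)) (f := fun k => μ (box r m k a b)) (by
      intro k
      simp only [Finset.mem_union, Finset.mem_Iio, Finset.mem_Ioo, Finset.mem_Ioi, Fin.lt_def,
        Fin.ext_iff] at *
      omega)]
  rw [Finset.prod_union, Finset.prod_union]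
  · have e1 : ∏ k ∈ Finset.Iio r, μ (box r m k a b) = ENNReal.ofReal (cF μ a) ^ (r : ℕ) := by
      rw [Finset.prod_congr rfl (g := fun _ => ENNReal.ofReal (cF μ a)), Finset.prod_const,
        Fin.card_Iio]
      intro k hk
      rw [box, if_pos (Finset.mem_Iio.1 hk), f1]
    have e2 : ∏ k ∈ Finset.Ioo r m, μ (box r m k a b)
        = ENNReal.ofReal (cF μ b - cF μ a) ^ (m - r - 1 : ℕ) := by
      rw [Finset.prod_congr rfl (g := fun _ => ENNReal.ofReal (cF μ b - cF μ a)),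
        Finset.prod_const, Fin.card_Ioo]
      intro k hk
      rw [Finset.mem_Ioo] at hk
      rw [box, if_neg hk.1.not_gt, if_pos hk.2, f3]
    have e3 : ∏ k ∈ Finset.Ioi m, μ (box r m k a b)
        = ENNReal.ofReal (1 - cF μ b) ^ (n - 1 - m : ℕ) := by
      rw [Finset.prod_congr rfl (g := fun _ => ENNReal.ofReal (1 - cF μ b)),
        Finset.prod_const, Fin.card_Ioi]
      intro k hk
      rw [Finset.mem_Ioi] at hk
      rw [box, if_neg (hrm.trans hk).not_gt, if_neg hk.not_gt, f2]
    have i1 : 0 ≤ cF μ a := (hin a).1.le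
    have i2 : 0 ≤ cF μ b - cF μ a := by linarith
    have i3 : 0 ≤ 1 - cF μ b := by linarith [(hin b).2]
    rw [e1, e2, e3, GG, if_pos hlt, ← ENNReal.ofReal_pow i1, ← ENNReal.ofReal_pow i2,
      ← ENNReal.ofReal_pow i3, ← ENNReal.ofReal_mul (by positivity),
      ← ENNReal.ofReal_mul (by positivity)]
  · rw [Finset.disjoint_left]; intro k
    simp only [Finset.mem_Iio, Finset.mem_Ioo, Fin.lt_def]; omega
  · rw [Finset.disjoint_left]; intro k
    simp only [Finset.mem_union, Finset.mem_Iio, Finset.mem_Ioo, Finset.mem_Ioi, Fin.lt_def] at *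
    omega

lemma EE_box {n : ℕ} (r m : Fin n) (hrm : r < m) (x : Fin n → ℝ) :
    EE r m x ↔ x r < x m ∧ ∀ k : {k // ¬ (k = r ∨ k = m)}, x k.1 ∈ box r m k.1 (x r) (x m) := by
  constructor
  · rintro ⟨h1, h2, h3, h4⟩
    refine ⟨h4, fun ⟨k, hk⟩ => ?_⟩
    simp only [not_or] at hk
    unfold box
    split_ifs with c1 c2
    · exact h1 k c1
    · exact h2 k (lt_of_le_of_ne (not_lt.1 c1) (Ne.symm hk.1)) c2
    · exact h3 k (lt_of_le_of_ne (not_lt.1 c2) (Ne.symm hk.2))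
  · rintro ⟨h4, h⟩
    refine ⟨fun k hk => ?_, fun k hk hk' => ?_, fun k hk => ?_, h4⟩
    · have := h ⟨k, by rintro (rfl | rfl); exacts [lt_irrefl _ hk, lt_asymm hk hrm]⟩
      simpa [box, hk] using this
    · have := h ⟨k, by rintro (rfl | rfl); exacts [lt_irrefl _ hk, lt_irrefl _ hk']⟩
      simpa [box, hk.not_gt, hk'] using this
    · have := h ⟨k, by rintro (rfl | rfl); exacts [lt_asymm hk hrm, lt_irrefl _ hk]⟩
      simpa [box, hk.not_gt, (hrm.trans hk).not_gt] using this

lemma EE_measure {n : ℕ} (μ : Measure ℝ) [IsProbabilityMeasure μ] (hF : Continuous (cF μ))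
    (hmono : StrictMono (cF μ)) (hr : Set.range (cF μ) = Set.Ioo 0 1)
    (r m : Fin n) (hrm : r < m) (A : Set (ℝ × ℝ)) (hA : MeasurableSet A) :
    sampleLaw n μ {x | EE r m x ∧ (x r, x m) ∈ A}
      = ∫⁻ z in A, GG r (m - r - 1) (n - 1 - m) (cF μ z.1) (cF μ z.2) ∂(μ.prod μ) := by
  let P : Fin n → Prop := fun k => k = r ∨ k = m
  let r' : Subtype P := ⟨r, Or.inl rfl⟩
  let m' : Subtype P := ⟨m, Or.inr rfl⟩
  have hne : r' ≠ m' := by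
    intro h; exact hrm.ne (congrArg Subtype.val h)
  let S' : Set ((Subtype P → ℝ) × ({k // ¬ P k} → ℝ)) :=
    {w | (w.1 r' < w.1 m' ∧ (w.1 r', w.1 m') ∈ A) ∧
      ∀ k : {k // ¬ P k}, w.2 k ∈ box r m k.1 (w.1 r') (w.1 m')}
  have m1 : ∀ i : Subtype P, Measurable fun w : (Subtype P → ℝ) × ({k // ¬ P k} → ℝ) => w.1 i :=
    fun i => (measurable_pi_apply i).comp measurable_fst
  have m2 : ∀ i : {k // ¬ P k},
      Measurable fun w : (Subtype P → ℝ) × ({k // ¬ P k} → ℝ) => w.2 i :=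
    fun i => (measurable_pi_apply i).comp measurable_snd
  have hS' : MeasurableSet S' := by
    suffices h : MeasurableSet {w : (Subtype P → ℝ) × ({k // ¬ P k} → ℝ) |
        ∀ k : {k // ¬ P k}, w.2 k ∈ box r m k.1 (w.1 r') (w.1 m')} from
      ((measurableSet_lt (m1 _) (m1 _)).inter (((m1 _).prodMk (m1 _)) hA)).inter h
    rw [Set.ofPred_forall]
    refine MeasurableSet.iInter fun k => ?_
    unfold box
    split_ifs with c1 c2
    · exact measurableSet_lt (m2 _) (m1 _)
    · exact (measurableSet_lt (m1 _) (m2 _)).inter (measurableSet_lt (m2 _) (m1 _))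
    · exact measurableSet_lt (m1 _) (m2 _)
  have hmp := measurePreserving_piEquivPiSubtypeProd (fun _ : Fin n => μ) P
  have e1 : {x : Fin n → ℝ | EE r m x ∧ (x r, x m) ∈ A}
      = (MeasurableEquiv.piEquivPiSubtypeProd (fun _ : Fin n => ℝ) P) ⁻¹' S' := by
    ext x
    have := EE_box r m hrm x
    change (EE r m x ∧ (x r, x m) ∈ A) ↔ ((x r < x m ∧ (x r, x m) ∈ A) ∧
      ∀ k : {k // ¬ P k}, x k.1 ∈ box r m k.1 (x r) (x m))
    rw [this]; tauto
  have hGm : Measurable fun z : ℝ × ℝ =>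
      GG r (m - r - 1) (n - 1 - m) (cF μ z.1) (cF μ z.2) :=
    (measurable_GG _ _ _).comp
      ((hF.measurable.comp measurable_fst).prodMk (hF.measurable.comp measurable_snd))
  rw [sampleLaw, e1, hmp.measure_preimage hS'.nullMeasurableSet, Measure.prod_apply hS',
    ← lintegral_indicator hA, ← pair_law μ hne, lintegral_map (hGm.indicator hA) (by fun_prop)]
  refine lintegral_congr fun z => ?_
  by_cases hz : z r' < z m' ∧ (z r', z m') ∈ A
  · have e2 : Prod.mk z ⁻¹' S'
        = Set.pi Set.univ fun k : {k // ¬ P k} => box r m k.1 (z r') (z m') := by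
      ext w
      change ((z r' < z m' ∧ (z r', z m') ∈ A) ∧
        ∀ k : {k // ¬ P k}, w k ∈ box r m k.1 (z r') (z m')) ↔ _
      simp [hz]
    rw [e2, Measure.pi_pi, Set.indicator_of_mem hz.2]
    exact prod_box μ hF hmono hr r m hrm _ _ hz.1
  · have e2 : Prod.mk z ⁻¹' S' = ∅ := by
      ext w
      change ((z r' < z m' ∧ (z r', z m') ∈ A) ∧
        ∀ k : {k // ¬ P k}, w k ∈ box r m k.1 (z r') (z m')) ↔ _
      simp [hz]
    rw [e2, measure_empty]
    by_cases hzA : (z r', z m') ∈ A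
    · have : ¬ cF μ (z r') < cF μ (z m') := by
        rw [hmono.lt_iff_lt]; tauto
      rw [Set.indicator_of_mem hzA, GG, if_neg this]
    · rw [Set.indicator_of_notMem hzA]

/-- joint law of two order statistics -/
lemma joint_law {n : ℕ} (μ : Measure ℝ) [IsProbabilityMeasure μ] (hF : Continuous (cF μ))
    (hmono : StrictMono (cF μ)) (hr : Set.range (cF μ) = Set.Ioo 0 1)
    (r m : Fin n) (hrm : r < m) :
    (sampleLaw n μ).map (fun x => (sortTuple x r, sortTuple x m))
      = (μ.prod μ).withDensity
        fun z => hd r (m - r - 1) (n - 1 - m) (cF μ z.1, cF μ z.2) := by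
  set p : ℕ := r.val
  set q : ℕ := m.val - r.val - 1
  set s : ℕ := n - 1 - m.val
  have hmap := map_cF μ hF hmono hr
  have hin : ∀ x, cF μ x ∈ Set.Ioo (0:ℝ) 1 := fun x => hr ▸ Set.mem_range_self x
  have hm : Measurable (fun x : Fin n → ℝ => (sortTuple x r, sortTuple x m)) :=
    (measurable_sortTuple r).prodMk (measurable_sortTuple m)
  have hGm : Measurable fun z : ℝ × ℝ => GG p q s (cF μ z.1) (cF μ z.2) :=
    (measurable_GG _ _ _).comp
      ((hF.measurable.comp measurable_fst).prodMk (hF.measurable.comp measurable_snd))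
  have hhm : Measurable fun z : ℝ × ℝ => hd p q s (cF μ z.1, cF μ z.2) := hGm.const_mul _
  have hN0 : (NN r m : ENNReal) ≠ 0 := by exact_mod_cast (NN_pos r m hrm).ne'
  have hNt : (NN r m : ENNReal) ≠ ⊤ := ENNReal.natCast_ne_top _
  have key : ∀ A : Set (ℝ × ℝ), MeasurableSet A →
      (NN r m : ENNReal) * (sampleLaw n μ).map (fun x => (sortTuple x r, sortTuple x m)) A
      = n.factorial * ∫⁻ z in A, GG p q s (cF μ z.1) (cF μ z.2) ∂(μ.prod μ) := fun A hA => by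
    rw [joint_law_EE μ (cF_facts μ hF hmono hr).1 r m hrm A hA,
      EE_measure μ hF hmono hr r m hrm A hA]
  have hprob : IsProbabilityMeasure (sampleLaw n μ) := by unfold sampleLaw; infer_instance
  have htot := key Set.univ MeasurableSet.univ
  rw [Measure.map_apply hm MeasurableSet.univ, Set.preimage_univ, measure_univ, mul_one,
    Measure.restrict_univ] at htot
  have hnorm : ENNReal.ofReal (KK p q s) * ∫⁻ z, GG p q s (cF μ z.1) (cF μ z.2) ∂(μ.prod μ) = 1 := by
    rw [← lintegral_const_mul _ hGm]
    change ∫⁻ z : ℝ × ℝ, hd p q s (cF μ z.1, cF μ z.2) ∂(μ.prod μ) = 1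
    rw [lintegral_prod _ hhm.aemeasurable]
    have : ∀ a, ∫⁻ b, hd p q s (cF μ a, cF μ b) ∂μ = bd p (q + s + 1) (cF μ a) := by
      intro a
      rw [← hd_marg1 p q s _ (hin a), ← hmap, lintegral_map _ hF.measurable]
      exact (measurable_hd p q s).comp (by fun_prop)
    simp only [this]
    rw [← lintegral_map (measurable_bd _ _) hF.measurable, hmap, bd_mass]
  ext A hA
  rw [withDensity_apply _ hA]
  have e : ∫⁻ z in A, hd p q s (cF μ z.1, cF μ z.2) ∂(μ.prod μ)
      = ENNReal.ofReal (KK p q s) * ∫⁻ z in A, GG p q s (cF μ z.1) (cF μ z.2) ∂(μ.prod μ) :=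
    lintegral_const_mul _ hGm
  rw [e]
  refine (ENNReal.mul_right_inj hN0 hNt).1 ?_
  rw [key A hA]
  rw [htot]
  calc _ = n.factorial * (ENNReal.ofReal (KK p q s)
        * ∫⁻ z, GG p q s (cF μ z.1) (cF μ z.2) ∂(μ.prod μ))
        * ∫⁻ z in A, GG p q s (cF μ z.1) (cF μ z.2) ∂(μ.prod μ) := by rw [hnorm, mul_one]
    _ = _ := by ring

lemma klDiv_joint (μ : Measure ℝ) [IsProbabilityMeasure μ] (hF : Continuous (cF μ))
    (hmono : StrictMono (cF μ)) (hr : Set.range (cF μ) = Set.Ioo 0 1) (p q s : ℕ)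
    (P : Measure (ℝ × ℝ)) (hPp : IsProbabilityMeasure P)
    (hP : P = (μ.prod μ).withDensity fun z => hd p q s (cF μ z.1, cF μ z.2)) :
    klDiv P ((P.map Prod.fst).prod (P.map Prod.snd))
      = ((T (p + q + 1) + T (q + s + 1) - T q - T (p + q + s + 2) : ℝ) : EReal) := by
  have hmap := map_cF μ hF hmono hr
  have hin : ∀ x, cF μ x ∈ Set.Ioo (0:ℝ) 1 := fun x => hr ▸ Set.mem_range_self x
  have hFm : Measurable (cF μ) := hF.measurable
  have hFF : Measurable (Prod.map (cF μ) (cF μ)) := hFm.prodMap hFm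
  have hh : Measurable fun z : ℝ × ℝ => hd p q s (cF μ z.1, cF μ z.2) :=
    (measurable_hd p q s).comp hFF
  have hb1 : Measurable fun a => bd p (q + s + 1) (cF μ a) := (measurable_bd _ _).comp hFm
  have hb2 : Measurable fun a => bd (p + q + 1) s (cF μ a) := (measurable_bd _ _).comp hFm
  have hfst : P.map Prod.fst = μ.withDensity fun a => bd p (q + s + 1) (cF μ a) := by
    rw [hP, map_fst_wd _ _ _ hh]
    congr 1; funext a
    rw [← hd_marg1 p q s _ (hin a), ← hmap, lintegral_map _ hFm]
    exact (measurable_hd p q s).comp (by fun_prop)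
  have hsnd : P.map Prod.snd = μ.withDensity fun a => bd (p + q + 1) s (cF μ a) := by
    rw [hP, map_snd_wd _ _ _ hh]
    congr 1; funext a
    rw [← hd_marg2 p q s _ (hin a), ← hmap, lintegral_map _ hFm]
    exact (measurable_hd p q s).comp (by fun_prop)
  set Q : Measure (ℝ × ℝ) := (P.map Prod.fst).prod (P.map Prod.snd) with hQ
  have hQd : Q = (μ.prod μ).withDensity
      fun z => bd p (q + s + 1) (cF μ z.1) * bd (p + q + 1) s (cF μ z.2) := by
    rw [hQ, hfst, hsnd, prod_withDensity hb1 hb2]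
  have hQp : IsProbabilityMeasure Q := by
    have := Measure.isProbabilityMeasure_map (μ := P) measurable_fst.aemeasurable
    have := Measure.isProbabilityMeasure_map (μ := P) measurable_snd.aemeasurable
    rw [hQ]; infer_instance
  let g : ℝ × ℝ → ENNReal := fun z => bd p (q + s + 1) (cF μ z.1) * bd (p + q + 1) s (cF μ z.2)
  have hg : Measurable g := (hb1.comp measurable_fst).mul (hb2.comp measurable_snd)
  let f : ℝ × ℝ → ENNReal := fun z => hd p q s (cF μ z.1, cF μ z.2) / g z
  have hf : Measurable f := hh.div hg
  have hPQ : P = Q.withDensity f := by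
    rw [hQd, hP, ← withDensity_mul _ hg hf]
    congr 1; funext z
    have h0 : g z ≠ 0 := mul_ne_zero
      (ENNReal.ofReal_pos.2 (bd_nonneg _ _ (hin _))).ne'
      (ENNReal.ofReal_pos.2 (bd_nonneg _ _ (hin _))).ne'
    have ht : g z ≠ ⊤ := ENNReal.mul_ne_top ENNReal.ofReal_ne_top ENNReal.ofReal_ne_top
    exact (ENNReal.mul_div_cancel h0 ht).symm
  have hac : P ≪ Q := by rw [hPQ]; exact withDensity_absolutelyContinuous _ _
  have hrn : P.rnDeriv Q =ᵐ[P] f := by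
    refine hac.ae_eq ?_
    have := Measure.rnDeriv_withDensity Q hf
    rwa [← hPQ] at this
  have hlt : ∀ᵐ z ∂P, z.1 < z.2 := by
    rw [hP, ae_withDensity_iff hh]
    refine ae_of_all _ fun z hz => ?_
    by_contra hc
    apply hz
    have : ¬ cF μ z.1 < cF μ z.2 := by rwa [hmono.lt_iff_lt]
    simp [hd, GG, this]
  let κ : ℝ := (p + q + 1).factorial * (q + s + 1).factorial
    / (q.factorial * (p + q + s + 2).factorial)
  have f1 : (0:ℝ) < p.factorial := by exact_mod_cast p.factorial_pos
  have f2 : (0:ℝ) < q.factorial := by exact_mod_cast q.factorial_pos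
  have f3 : (0:ℝ) < s.factorial := by exact_mod_cast s.factorial_pos
  have f4 : (0:ℝ) < (p + q + 1).factorial := by exact_mod_cast Nat.factorial_pos _
  have f5 : (0:ℝ) < (q + s + 1).factorial := by exact_mod_cast Nat.factorial_pos _
  have f6 : (0:ℝ) < (p + q + s + 2).factorial := by exact_mod_cast Nat.factorial_pos _
  have hlog : ∀ᵐ z ∂P, Real.log ((P.rnDeriv Q z).toReal)
      = Real.log κ + q * Real.log (cF μ z.2 - cF μ z.1)
        - (q + s + 1 : ℕ) * Real.log (1 - cF μ z.1) - (p + q + 1 : ℕ) * Real.log (cF μ z.2) := by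
    filter_upwards [hrn, hlt] with z hz hz'
    have hm := hmono hz'
    obtain ⟨a1, a2⟩ := hin z.1
    obtain ⟨b1, b2⟩ := hin z.2
    rw [hz]
    simp only [f, g, hd, GG, if_pos hm, bd]
    set u := cF μ z.1
    set v := cF μ z.2
    have c1 : 0 < v - u := by linarith
    have c2 : 0 < 1 - u := by linarith
    have c3 : 0 < 1 - v := by linarith
    have e : (ENNReal.ofReal (KK p q s) * ENNReal.ofReal (u ^ p * (v - u) ^ q * (1 - v) ^ s) /
        (ENNReal.ofReal (((p + (q + s + 1) + 1).factorial / (p.factorial * (q + s + 1).factorial) : ℝ)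
            * (u ^ p * (1 - u) ^ (q + s + 1)))
          * ENNReal.ofReal (((p + q + 1 + s + 1).factorial / ((p + q + 1).factorial * s.factorial) : ℝ)
            * (v ^ (p + q + 1) * (1 - v) ^ s)))).toReal
        = κ * (v - u) ^ q / (1 - u) ^ (q + s + 1) / v ^ (p + q + 1) := by
      rw [ENNReal.toReal_div, ENNReal.toReal_mul, ENNReal.toReal_mul,
        ENNReal.toReal_ofReal (KK_pos p q s).le, ENNReal.toReal_ofReal (by positivity),
        ENNReal.toReal_ofReal (bd_nonneg p (q + s + 1) ⟨a1, a2⟩).le,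
        ENNReal.toReal_ofReal (bd_nonneg (p + q + 1) s ⟨b1, b2⟩).le, KK,
        show p + (q + s + 1) + 1 = p + q + s + 2 by ring,
        show p + q + 1 + s + 1 = p + q + s + 2 by ring]
      simp only [κ]
      field_simp
    rw [e, Real.log_div (by positivity) (by positivity), Real.log_div (by positivity) (by positivity),
      Real.log_mul (by positivity) (by positivity), Real.log_pow, Real.log_pow, Real.log_pow]
  have hU : P.map (Prod.map (cF μ) (cF μ)) = U2 p q s := by
    rw [hP, U2, ← hmap, Measure.map_prod_map _ _ hFm hFm]
    exact map_wd_comp _ _ hFF _ (measurable_hd p q s)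
  have hV1 : P.map (fun z => cF μ z.1) = betaM p (q + s + 1) := by
    rw [← U2_fst, ← hU, Measure.map_map measurable_fst hFF]; rfl
  have hV2 : P.map (fun z => cF μ z.2) = betaM (p + q + 1) s := by
    rw [← U2_snd, ← hU, Measure.map_map measurable_snd hFF]; rfl
  have hV3 : P.map (fun z => cF μ z.2 - cF μ z.1) = betaM q (p + s + 1) := by
    rw [← U2_sub, ← hU, Measure.map_map (by fun_prop) hFF]; rfl
  have mV1 : Measurable fun z : ℝ × ℝ => cF μ z.1 := hFm.comp measurable_fst
  have mV2 : Measurable fun z : ℝ × ℝ => cF μ z.2 := hFm.comp measurable_snd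
  have mV3 : Measurable fun z : ℝ × ℝ => cF μ z.2 - cF μ z.1 := mV2.sub mV1
  have ml : Measurable fun x : ℝ => Real.log (1 - x) :=
    Real.measurable_log.comp (by fun_prop)
  obtain ⟨i1, j1⟩ := betaM_log_one_sub p (q + s + 1)
  obtain ⟨i2, j2⟩ := betaM_log (p + q + 1) s
  obtain ⟨i3, j3⟩ := betaM_log q (p + s + 1)
  rw [← hV1, integrable_map_measure ml.aestronglyMeasurable mV1.aemeasurable] at i1
  rw [← hV2, integrable_map_measure Real.measurable_log.aestronglyMeasurable
    mV2.aemeasurable] at i2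
  rw [← hV3, integrable_map_measure Real.measurable_log.aestronglyMeasurable
    mV3.aemeasurable] at i3
  rw [← hV1, integral_map mV1.aemeasurable ml.aestronglyMeasurable] at j1
  rw [← hV2, integral_map mV2.aemeasurable Real.measurable_log.aestronglyMeasurable] at j2
  rw [← hV3, integral_map mV3.aemeasurable Real.measurable_log.aestronglyMeasurable] at j3
  simp only [Function.comp_def] at i1 i2 i3
  rw [klDiv, if_pos hac, integral_congr_ae hlog]
  congr 1
  rw [integral_sub, integral_sub, integral_add, integral_const, integral_const_mul,
    integral_const_mul, integral_const_mul, j1, j2, j3]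
  · rw [show p + (q + s + 1) + 1 = p + q + s + 2 by ring,
      show p + q + 1 + s + 1 = p + q + s + 2 by ring,
      show q + (p + s + 1) + 1 = p + q + s + 2 by ring]
    simp only [κ, T, probReal_univ, one_smul]
    rw [Real.log_div (by positivity) (by positivity), Real.log_mul (by positivity) (by positivity),
      Real.log_mul (by positivity) (by positivity)]
    push_cast
    ring
  · exact integrable_const _
  · exact i3.const_mul _
  · exact (integrable_const _).add (i3.const_mul _)
  · exact i1.const_mul _
  · exact ((integrable_const _).add (i3.const_mul _)).sub (i1.const_mul _)
  · exact i2.const_mul _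

/-- Exact value of the mutual information between the `r`-th and `m`-th order statistics
(1-based indexing) for a sampling distribution with an invertible cdf:
`I(X_(r); X_(m)) = T_(m-1) + T_(n-r) - T_(m-r-1) - T_n`. -/
theorem mutualInfo_orderStatistics_eq
    (n : ℕ) (μ : Measure ℝ) [IsProbabilityMeasure μ]
    (hF : Continuous fun x => (μ (Set.Iic x)).toReal)
    (hFmono : StrictMono fun x => (μ (Set.Iic x)).toReal)
    (hFrange : Set.range (fun x => (μ (Set.Iic x)).toReal) = Set.Ioo 0 1)
    (r m : ℕ) (hr : 1 ≤ r) (hrm : r < m) (hmn : m ≤ n) :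
    miPair n μ ⟨r - 1, by omega⟩ ⟨m - 1, by omega⟩
      = ((T (m - 1) + T (n - r) - T (m - r - 1) - T n : ℝ) : EReal) := by
  have hF' : Continuous (cF μ) := hF
  have hmono : StrictMono (cF μ) := hFmono
  have hrange : Set.range (cF μ) = Set.Ioo 0 1 := hFrange
  have hr1 : r - 1 < n := by omega
  have hm1 : m - 1 < n := by omega
  let r' : Fin n := ⟨r - 1, hr1⟩
  let m' : Fin n := ⟨m - 1, hm1⟩
  have hlt : r' < m' := by
    change r - 1 < m - 1
    omega
  have hm : Measurable (fun x : Fin n → ℝ => (sortTuple x r', sortTuple x m')) :=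
    (measurable_sortTuple r').prodMk (measurable_sortTuple m')
  have hprob : IsProbabilityMeasure (sampleLaw n μ) := by unfold sampleLaw; infer_instance
  have h := klDiv_joint μ hF' hmono hrange (r - 1) (m - 1 - (r - 1) - 1) (n - 1 - (m - 1))
    ((sampleLaw n μ).map (fun x => (sortTuple x r', sortTuple x m')))
    (Measure.isProbabilityMeasure_map hm.aemeasurable)
    (joint_law μ hF' hmono hrange r' m' hlt)
  rw [Measure.map_map measurable_fst hm, Measure.map_map measurable_snd hm] at h
  have e1 : r - 1 + (m - 1 - (r - 1) - 1) + 1 = m - 1 := by omega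
  have e2 : m - 1 - (r - 1) - 1 + (n - 1 - (m - 1)) + 1 = n - r := by omega
  have e3 : r - 1 + (m - 1 - (r - 1) - 1) + (n - 1 - (m - 1)) + 2 = n := by omega
  have e4 : m - 1 - (r - 1) - 1 = m - r - 1 := by omega
  rw [e1, e2, e3, e4] at h
  exact h
end
end
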